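/- Let ε ∈ (0,1) be irrational and assume 1/(2π) < C(t) < ∞ for all t. Then the capacity C_ε of the channel Y_ε[i] = X[i] + W_ε[i] under the average power constraint P satisfies C_ε ≤ liminf_{n→∞} C_n, where C_n is the capacity of the channel Y_n[i] = X[i] + W_n[i] with W_n[i] = W_c(i·T_c/(p+ε_n)), ε_n = ⌊n·ε⌋/n, under the same power constraint. -/

import Mathlib

open MeasureTheory ProbabilityTheory Filter Topology
open scoped NNReal ENNReal

/-- The law of a block of `l` samples of the memoryless zero-mean Gaussian noise whose
variance at time `i` is `σ2 i`. -/
noncomputable def noiseMeasure (σ2 : ℕ → ℝ) (l : ℕ) : Measure (Fin l → ℝ) :=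
  Measure.pi fun i : Fin l => gaussianReal 0 (σ2 (i : ℕ)).toNNReal

/-- The average power constraint `(1/l) ∑ᵢ |x[i]|² ≤ P` on a codeword `x` of blocklength `l`. -/
def powerConstraint (P : ℝ) (l : ℕ) (x : Fin l → ℝ) : Prop :=
  (1 / (l : ℝ)) * ∑ i, (x i) ^ 2 ≤ P

/-- The average probability of error of a code with `M` equiprobable messages, encoder `enc`
and decoder `dec`, and blocklength `l`, over the memoryless additive Gaussian noise channel
`Y[i] = x[i] + W[i]` with noise variances `σ2`. -/
noncomputable def avgError (σ2 : ℕ → ℝ) (l M : ℕ)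
    (enc : Fin M → Fin l → ℝ) (dec : (Fin l → ℝ) → Fin M) : ℝ :=
  (1 / (M : ℝ)) * ∑ u : Fin M,
    ((noiseMeasure σ2 l) {w | dec (fun i => enc u i + w i) ≠ u}).toReal

/-- A rate `R_s` is achievable if, for every `η₁, η₂ > 0` and every sufficiently large
blocklength `l`, there is a code whose (power-constrained) codewords have average error
probability below `η₁` and rate `log₂(M)/l ≥ R_s − η₂`. -/
def IsAchievableRate (σ2 : ℕ → ℝ) (P R_s : ℝ) : Prop :=
  ∀ η₁ > (0 : ℝ), ∀ η₂ > (0 : ℝ), ∃ l₀ : ℕ, ∀ l > l₀,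
    ∃ (M : ℕ) (enc : Fin M → Fin l → ℝ) (dec : (Fin l → ℝ) → Fin M),
      (∀ u, powerConstraint P l (enc u)) ∧
      avgError σ2 l M enc dec < η₁ ∧
      Real.logb 2 (M : ℝ) / (l : ℝ) ≥ R_s - η₂

/-- The capacity of the memoryless additive Gaussian noise channel with noise variances `σ2`
under the average power constraint `P`: the supremum of all achievable rates. -/
noncomputable def capacity (σ2 : ℕ → ℝ) (P : ℝ) : ℝ :=
  sSup {R : ℝ | IsAchievableRate σ2 P R}


lemma aux_pi_mono {l : ℕ} (μ ν : Fin l → Measure ℝ) [∀ i, SigmaFinite (μ i)]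
    [∀ i, SigmaFinite (ν i)] (h : ∀ i, μ i ≤ ν i) : Measure.pi μ ≤ Measure.pi ν := by
  have h1 : (Measure.pi μ).toOuterMeasure ≤ OuterMeasure.pi fun i => (ν i).toOuterMeasure := by
    rw [OuterMeasure.le_pi]
    intro s _
    change Measure.pi μ (Set.univ.pi s) ≤ _
    rw [Measure.pi_pi]
    exact Finset.prod_le_prod' fun i _ => h i (s i)
  refine Measure.le_iff.2 fun A hA => ?_
  have h2 : Measure.pi ν A = (OuterMeasure.pi fun i => (ν i).toOuterMeasure) A := by
    rw [Measure.pi_def, toMeasure_apply _ _ hA]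
  rw [h2]
  exact h1 A

lemma aux_gauss_le (v : ℝ≥0) (hv : 1 / (2 * Real.pi) ≤ (v : ℝ)) :
    gaussianReal 0 v ≤ (volume : Measure ℝ) := by
  have hpi := Real.pi_pos
  have hpos : 0 < (v : ℝ) := lt_of_lt_of_le (by positivity) hv
  have hv0 : v ≠ 0 := by
    rintro rfl
    simp at hpos
  rw [gaussianReal_of_var_ne_zero _ hv0]
  refine (withDensity_mono (g := fun _ => 1) ?_).trans ?_
  · refine Filter.Eventually.of_forall fun x => ?_
    rw [gaussianPDF]
    refine ENNReal.ofReal_le_one.2 ?_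
    rw [gaussianPDFReal]
    have h1 : 1 ≤ 2 * Real.pi * v := by
      rw [div_le_iff₀ (by positivity)] at hv
      linarith
    have h2 : 1 ≤ √(2 * Real.pi * v) := Real.one_le_sqrt.2 h1
    have h3 : Real.exp (-(x - 0) ^ 2 / (2 * v)) ≤ 1 := by
      rw [Real.exp_le_one_iff]
      apply div_nonpos_of_nonpos_of_nonneg
      · nlinarith [sq_nonneg (x - 0)]
      · positivity
    have h4 : (√(2 * Real.pi * v))⁻¹ ≤ 1 := inv_le_one_of_one_le₀ h2
    exact mul_le_one₀ h4 (Real.exp_nonneg _) h3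
  · simp

instance aux_noise_prob (σ2 : ℕ → ℝ) (l : ℕ) : IsProbabilityMeasure (noiseMeasure σ2 l) := by
  unfold noiseMeasure
  infer_instance

lemma aux_noise_le (σ2 : ℕ → ℝ) (l : ℕ) (h : ∀ i, 1 / (2 * Real.pi) ≤ σ2 i) :
    noiseMeasure σ2 l ≤ volume := by
  unfold noiseMeasure
  rw [volume_pi]
  refine aux_pi_mono _ _ fun i => aux_gauss_le _ ?_
  exact (h _).trans (Real.le_coe_toNNReal _)

lemma aux_vol_ball (l : ℕ) (K : ℝ) :
    (volume : Measure (Fin l → ℝ)) {y | ∑ i, y i ^ 2 ≤ l * K} ≤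
      ENNReal.ofReal ((Real.exp K * √Real.pi) ^ l) := by
  have hint : Integrable (fun y : Fin l → ℝ => ∏ i, Real.exp (-1 * y i ^ 2)) := by
    exact Integrable.fintype_prod (f := fun _ x => Real.exp (-1 * x ^ 2))
      (fun i => integrable_exp_neg_mul_sq one_pos)
  have hI : ∫ y : Fin l → ℝ, ∏ i, Real.exp (-1 * y i ^ 2) = √Real.pi ^ l := by
    rw [integral_fintype_prod_volume_eq_pow (fun x : ℝ => Real.exp (-1 * x ^ 2)),
      integral_gaussian]
    simp
  have hM := mul_meas_ge_le_integral_of_nonneg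
    (Filter.Eventually.of_forall fun y => by positivity) hint (Real.exp (-(l * K)))
  have hfin : (volume : Measure (Fin l → ℝ)) {y | ∑ i, y i ^ 2 ≤ l * K} ≤
      volume {y : Fin l → ℝ | Real.exp (-(l * K)) ≤ ∏ i, Real.exp (-1 * y i ^ 2)} := by
    refine measure_mono fun y hy => ?_
    simp only [Set.mem_ofPred_eq] at hy ⊢
    rw [← Real.exp_sum, Real.exp_le_exp]
    simp only [neg_mul, one_mul, Finset.sum_neg_distrib]
    linarith
  refine hfin.trans ?_
  have hne : volume {y : Fin l → ℝ | Real.exp (-(l * K)) ≤ ∏ i, Real.exp (-1 * y i ^ 2)} ≠ ⊤ :=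
    (hint.measure_ge_lt_top (Real.exp_pos _)).ne
  rw [ENNReal.le_ofReal_iff_toReal_le hne (by positivity)]
  rw [hI, Measure.real] at hM
  rw [mul_pow, ← Real.exp_nat_mul]
  rw [Real.exp_neg, inv_mul_le_iff₀ (Real.exp_pos _)] at hM
  rw [← Real.exp_neg] at hM
  exact hM

lemma aux_tail (σ2 : ℕ → ℝ) (l : ℕ) (hl : 0 < l) (S : ℝ) (hS : 0 < S) (h0 : ∀ i, 0 ≤ σ2 i)
    (h : ∀ i, σ2 i ≤ S) :
    (noiseMeasure σ2 l).real {w | 4 * S * l ≤ ∑ i, w i ^ 2} ≤ 1 / 4 := by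
  have hint : ∀ i : Fin l, Integrable (fun w : Fin l → ℝ => w i ^ 2) (noiseMeasure σ2 l) := by
    intro i
    unfold noiseMeasure
    exact integrable_comp_eval (μ := fun i : Fin l => gaussianReal 0 (σ2 (i : ℕ)).toNNReal)
      (f := fun x : ℝ => x ^ 2)
      ((memLp_id_gaussianReal (p := 2)).integrable_sq)
  have hval : ∀ i : Fin l, ∫ w, w i ^ 2 ∂(noiseMeasure σ2 l) ≤ S := by
    intro i
    unfold noiseMeasure
    rw [integral_comp_eval (μ := fun i : Fin l => gaussianReal 0 (σ2 (i : ℕ)).toNNReal)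
      (f := fun x : ℝ => x ^ 2) (by fun_prop)]
    have hv := variance_id_gaussianReal (μ := 0) (v := (σ2 (i : ℕ)).toNNReal)
    rw [variance_of_integral_eq_zero (by fun_prop) (by simp)] at hv
    simp only [id] at hv
    rw [hv, Real.coe_toNNReal _ (h0 _)]
    exact h _
  have hM := mul_meas_ge_le_integral_of_nonneg (μ := noiseMeasure σ2 l)
    (f := fun w : Fin l → ℝ => ∑ i, w i ^ 2)
    (Filter.Eventually.of_forall fun y => by positivity) (integrable_finsetSum _ fun i _ => hint i)
    (4 * S * l)
  rw [integral_finsetSum _ fun i _ => hint i] at hM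
  have h2 : ∑ i : Fin l, ∫ w, w i ^ 2 ∂(noiseMeasure σ2 l) ≤ l * S := by
    refine (Finset.sum_le_sum fun i _ => hval i).trans ?_
    simp
  have hl' : (0 : ℝ) < l := by exact_mod_cast hl
  have h3 : (S * l) * (4 * (noiseMeasure σ2 l).real {w | 4 * S * l ≤ ∑ i, w i ^ 2}) ≤ (S * l) * 1 := by
    nlinarith
  have := le_of_mul_le_mul_left h3 (by positivity)
  linarith

lemma aux_converse (σ2 : ℕ → ℝ) (l M : ℕ) (hl : 0 < l) (S P : ℝ) (hS : 0 < S)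
    (hlo : ∀ i, 1 / (2 * Real.pi) ≤ σ2 i) (hup : ∀ i, σ2 i ≤ S)
    (enc : Fin M → Fin l → ℝ) (dec : (Fin l → ℝ) → Fin M)
    (hpow : ∀ u, powerConstraint P l (enc u))
    (herr : avgError σ2 l M enc dec < 1 / 4) :
    (M : ℝ) ≤ 2 * (Real.exp (2 * (P + 4 * S)) * √Real.pi) ^ l := by
  have hpi := Real.pi_pos
  have hl' : (0 : ℝ) < l := by exact_mod_cast hl
  have hM0 : 0 < M := (dec 0).pos
  have hM' : (0 : ℝ) < M := by exact_mod_cast hM0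
  set K := 2 * (P + 4 * S) with hK
  set μ := noiseMeasure σ2 l with hμ
  let E : Fin M → Set (Fin l → ℝ) := fun u => {w | dec (fun i => enc u i + w i) ≠ u}
  let B : Set (Fin l → ℝ) := {y | ∑ i, y i ^ 2 ≤ l * K}
  let A : Fin M → Set (Fin l → ℝ) := fun u => (fun y => (- enc u) + y) ⁻¹' (toMeasurable μ (E u))ᶜ
  have hBm : MeasurableSet B := measurableSet_le (by fun_prop) (by fun_prop)
  have hAm : ∀ u, MeasurableSet (A u) := fun u =>
    (measurableSet_toMeasurable _ _).compl.preimage (by fun_prop)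
  have hAsub : ∀ u, ∀ y ∈ A u, dec y = u := by
    intro u y hy
    by_contra hne
    apply hy
    apply subset_toMeasurable
    change dec (fun i => enc u i + (-enc u + y) i) ≠ u
    have : (fun i => enc u i + (-enc u + y) i) = y := by
      ext i
      simp
    rwa [this]
  have hdisj : Pairwise (Function.onFun Disjoint fun u => A u ∩ B) := by
    intro u v huv
    refine Set.disjoint_left.2 fun y hy hy' => huv ?_
    rw [← hAsub u y hy.1, hAsub v y hy'.1]
  have hsum : ∑ u, volume (A u ∩ B) ≤ volume B := by
    rw [← tsum_fintype (L := .unconditional _), ← measure_iUnion hdisj (fun u => (hAm u).inter hBm)]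
    exact measure_mono (Set.iUnion_subset fun u => Set.inter_subset_right)
  have hvB := aux_vol_ball l K
  have hBtop : volume B ≠ ⊤ := ne_top_of_le_ne_top ENNReal.ofReal_ne_top hvB
  have hABtop : ∀ u, volume (A u ∩ B) ≠ ⊤ := fun u =>
    ne_top_of_le_ne_top hBtop (measure_mono Set.inter_subset_right)
  have key : ∀ u, 1 ≤ (μ (E u)).toReal + 1 / 4 + (volume (A u ∩ B)).toReal := by
    intro u
    have hcov : (Set.univ : Set (Fin l → ℝ)) ⊆ (toMeasurable μ (E u) ∪
        {w | 4 * S * l ≤ ∑ i, w i ^ 2}) ∪ (fun w => enc u + w) ⁻¹' (A u ∩ B) := by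
      intro w _
      by_cases h1 : w ∈ toMeasurable μ (E u)
      · exact Or.inl (Or.inl h1)
      by_cases h2 : 4 * S * l ≤ ∑ i, w i ^ 2
      · exact Or.inl (Or.inr h2)
      refine Or.inr ⟨?_, ?_⟩
      · change -enc u + (enc u + w) ∈ (toMeasurable μ (E u))ᶜ
        rwa [neg_add_cancel_left]
      · change ∑ i, (enc u i + w i) ^ 2 ≤ l * K
        have h3 := hpow u
        unfold powerConstraint at h3
        rw [one_div, inv_mul_le_iff₀ hl'] at h3
        push Not at h2
        have h4 : ∑ i, (enc u i + w i) ^ 2 ≤ ∑ i, (2 * enc u i ^ 2 + 2 * w i ^ 2) :=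
          Finset.sum_le_sum fun i _ => by nlinarith [sq_nonneg (enc u i - w i)]
        rw [Finset.sum_add_distrib, ← Finset.mul_sum, ← Finset.mul_sum] at h4
        rw [hK]
        nlinarith
    have h5 : μ.real Set.univ ≤ (μ.real (toMeasurable μ (E u)) +
        μ.real {w | 4 * S * l ≤ ∑ i, w i ^ 2}) + μ.real ((fun w => enc u + w) ⁻¹' (A u ∩ B)) :=
      (measureReal_mono hcov).trans ((measureReal_union_le _ _).trans
        (by gcongr; exact measureReal_union_le _ _))
    have h6 : μ ((fun w => enc u + w) ⁻¹' (A u ∩ B)) ≤ volume (A u ∩ B) := by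
      refine (aux_noise_le σ2 l hlo _).trans ?_
      rw [measure_preimage_add]
    have h7 : μ.real ((fun w => enc u + w) ⁻¹' (A u ∩ B)) ≤ (volume (A u ∩ B)).toReal :=
      ENNReal.toReal_mono (hABtop u) h6
    have h8 : μ.real (toMeasurable μ (E u)) = (μ (E u)).toReal := by
      rw [Measure.real, measure_toMeasurable]
    have h9 := aux_tail σ2 l hl S hS (fun i => (by positivity : (0:ℝ) ≤ 1 / (2 * Real.pi)).trans (hlo i)) hup
    rw [probReal_univ] at h5
    linarith
  have hsum2 : (M : ℝ) ≤ ∑ u, (μ (E u)).toReal + M * (1 / 4) + ∑ u, (volume (A u ∩ B)).toReal := by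
    have := Finset.sum_le_sum fun u (_ : u ∈ Finset.univ) => key u
    rw [Finset.sum_add_distrib, Finset.sum_add_distrib] at this
    simpa using this
  have hs3 : ∑ u, (volume (A u ∩ B)).toReal ≤ (Real.exp K * √Real.pi) ^ l := by
    rw [← ENNReal.toReal_sum fun u _ => hABtop u]
    exact ENNReal.toReal_le_of_le_ofReal (by positivity) (hsum.trans hvB)
  have hs4 : ∑ u, (μ (E u)).toReal < M * (1 / 4) := by
    unfold avgError at herr
    rw [one_div, inv_mul_lt_iff₀ hM'] at herr
    exact herr
  linarith

lemma aux_rate_bound (σ2 : ℕ → ℝ) (S P R : ℝ) (hS : 0 < S)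
    (hlo : ∀ i, 1 / (2 * Real.pi) ≤ σ2 i) (hup : ∀ i, σ2 i ≤ S)
    (hR : IsAchievableRate σ2 P R) :
    R ≤ 2 + Real.logb 2 (Real.exp (2 * (P + 4 * S)) * √Real.pi) := by
  obtain ⟨l₀, h⟩ := hR (1 / 4) (by norm_num) 1 one_pos
  obtain ⟨M, enc, dec, h1, h2, h3⟩ := h (l₀ + 1) (by omega)
  have hb := aux_converse σ2 (l₀ + 1) M (by omega) S P hS hlo hup enc dec h1 h2
  have hpi := Real.pi_pos
  have hM0 : 0 < M := (dec 0).pos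
  have hM' : (0 : ℝ) < M := by exact_mod_cast hM0
  set A := Real.exp (2 * (P + 4 * S)) * √Real.pi with hA
  have hA0 : 0 < A := by positivity
  have h4 : Real.logb 2 M ≤ 1 + (l₀ + 1 : ℕ) * Real.logb 2 A := by
    refine (Real.logb_le_logb_of_le one_lt_two hM' hb).trans ?_
    rw [Real.logb_mul two_ne_zero (by positivity), Real.logb_pow, Real.logb_self_eq_one one_lt_two]
  have hl : (1 : ℝ) ≤ (l₀ + 1 : ℕ) := by push_cast; linarith [Nat.cast_nonneg (α := ℝ) l₀]
  rw [ge_iff_le, le_div_iff₀ (by linarith)] at h3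
  by_contra hcon
  push Not at hcon
  nlinarith

lemma aux_law (σ2 σ2' : ℕ → ℝ) (L L' : ℕ) (e : Fin L' → Fin L) (he : Function.Injective e)
    (s : ℝ) (hs : 0 < s) (h0 : ∀ i, 0 ≤ σ2' i)
    (h : ∀ j : Fin L', σ2' (e j : ℕ) ≤ s ^ 2 * σ2 (j : ℕ)) :
    ∃ ν : Measure (Fin L' → ℝ), IsProbabilityMeasure ν ∧
      ((noiseMeasure σ2' L).prod ν).map
        (fun p : (Fin L → ℝ) × (Fin L' → ℝ) => fun j => s⁻¹ * p.1 (e j) + p.2 j) =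
      noiseMeasure σ2 L' := by
  let a : Fin L' → Measure ℝ := fun j => gaussianReal 0 ((s⁻¹) ^ 2 * σ2' (e j : ℕ)).toNNReal
  let b : Fin L' → Measure ℝ := fun j =>
    gaussianReal 0 (σ2 (j : ℕ) - (s⁻¹) ^ 2 * σ2' (e j : ℕ)).toNNReal
  have hmap1 : (noiseMeasure σ2' L).map (fun w j => s⁻¹ * w (e j)) = Measure.pi a := by
    have hind : iIndepFun (fun (i : Fin L) (w : Fin L → ℝ) => s⁻¹ * w i) (noiseMeasure σ2' L) :=
      iIndepFun_pi (μ := fun i : Fin L => gaussianReal 0 (σ2' (i : ℕ)).toNNReal)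
        (X := fun _ x => s⁻¹ * x) (fun i => by fun_prop)
    have hind2 := hind.precomp he
    have hh := (iIndepFun_iff_map_fun_eq_pi_map
      (fun i => (by fun_prop : Measurable fun w : Fin L → ℝ => s⁻¹ * w (e i)).aemeasurable)).1 hind2
    refine hh.trans ?_
    congr 1
    ext1 j
    change Measure.map ((fun x => s⁻¹ * x) ∘ (fun w : Fin L → ℝ => w (e j))) _ = _
    rw [← Measure.map_map (by fun_prop) (by fun_prop)]
    unfold noiseMeasure
    rw [(measurePreserving_eval _ (e j)).map_eq, gaussianReal_map_const_mul]
    simp only [a, mul_zero]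
    congr 1
    rw [Real.toNNReal_mul (by positivity)]
    congr 1
    ext
    simp [Real.coe_toNNReal _ (show 0 ≤ (s ^ 2)⁻¹ by positivity)]
  refine ⟨Measure.pi b, inferInstance, ?_⟩
  have hcomp : (fun p : (Fin L → ℝ) × (Fin L' → ℝ) => fun j => s⁻¹ * p.1 (e j) + p.2 j) =
      (fun q : (Fin L' → ℝ) × (Fin L' → ℝ) => fun j => q.1 j + q.2 j) ∘
        Prod.map (fun w j => s⁻¹ * w (e j)) id := by
    ext p j
    simp
  rw [hcomp, ← Measure.map_map (by fun_prop) (by fun_prop),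
    ← Measure.map_prod_map _ _ (by fun_prop) (by fun_prop), hmap1, Measure.map_id]
  rw [← (measurePreserving_arrowProdEquivProdArrow ℝ ℝ (Fin L') a b).map_eq,
    Measure.map_map (by fun_prop) (by fun_prop)]
  have h3 : ((fun q : (Fin L' → ℝ) × (Fin L' → ℝ) => fun j => q.1 j + q.2 j) ∘
      (MeasurableEquiv.arrowProdEquivProdArrow ℝ ℝ (Fin L'))) =
      fun x j => (fun y : ℝ × ℝ => y.1 + y.2) (x j) := by
    ext x j
    rfl
  have hconv : ∀ j : Fin L', ((a j).prod (b j)).map (fun y : ℝ × ℝ => y.1 + y.2) =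
      gaussianReal 0 (σ2 (j : ℕ)).toNNReal := by
    intro j
    change a j ∗ b j = _
    rw [gaussianReal_conv_gaussianReal, ← Real.toNNReal_add]
    · simp
    · have := h0 (e j : ℕ)
      positivity
    · have h4 : (s⁻¹) ^ 2 * σ2' (e j : ℕ) ≤ σ2 (j : ℕ) := by
        rw [inv_pow, inv_mul_le_iff₀ (by positivity)]
        exact h j
      linarith
  have hpp := Measure.pi_map_pi (μ := fun j => (a j).prod (b j))
    (f := fun _ (y : ℝ × ℝ) => y.1 + y.2)
    (hμ := fun j => by rw [hconv j]; infer_instance) (fun j => by fun_prop)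
  rw [h3]
  refine hpp.trans ?_
  unfold noiseMeasure
  congr 1
  ext1 j
  exact hconv j

lemma aux_sim (σ2 σ2' : ℕ → ℝ) (L L' M : ℕ) (e : Fin L' → Fin L) (he : Function.Injective e)
    (s P : ℝ) (hs : 0 < s) (h0 : ∀ i, 0 ≤ σ2' i) (hP : 0 ≤ P)
    (h : ∀ j : Fin L', σ2' (e j : ℕ) ≤ s ^ 2 * σ2 (j : ℕ))
    (hL' : 0 < L') (hLL : s ^ 2 * L' ≤ L)
    (enc : Fin M → Fin L' → ℝ) (dec : (Fin L' → ℝ) → Fin M)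
    (hpow : ∀ u, powerConstraint P L' (enc u)) :
    ∃ (enc' : Fin M → Fin L → ℝ) (dec' : (Fin L → ℝ) → Fin M),
      (∀ u, powerConstraint P L (enc' u)) ∧
      avgError σ2' L M enc' dec' ≤ avgError σ2 L' M enc dec := by
  classical
  obtain ⟨ν, hν, hlaw⟩ := aux_law σ2 σ2' L L' e he s hs h0 h
  have hL'r : (0 : ℝ) < L' := by exact_mod_cast hL'
  have hLr : (0 : ℝ) < L := lt_of_lt_of_le (by positivity) hLL
  set μ := noiseMeasure σ2 L' with hμ
  set μ' := noiseMeasure σ2' L with hμ'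
  let E : Fin M → Set (Fin L' → ℝ) := fun u => {w | dec (fun i => enc u i + w i) ≠ u}
  let T : Fin M → Set (Fin L' → ℝ) := fun u => toMeasurable μ (E u)
  let f : (Fin L → ℝ) × (Fin L' → ℝ) → Fin L' → ℝ := fun p j => s⁻¹ * p.1 (e j) + p.2 j
  have hf : Measurable f := by fun_prop
  have hTm : ∀ u, MeasurableSet (f ⁻¹' T u) := fun u => (measurableSet_toMeasurable _ _).preimage hf
  have h1 : ∀ u, μ (E u) = ∫⁻ z, μ' ((fun w => (w, z)) ⁻¹' (f ⁻¹' T u)) ∂ν := by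
    intro u
    rw [← measure_toMeasurable (E u), ← hlaw, Measure.map_apply hf (measurableSet_toMeasurable _ _),
      Measure.prod_apply_symm]
    · rw [hlaw]
    · rw [hlaw]
      exact hTm u
  obtain ⟨z, hz⟩ : ∃ z, ∑ u, μ' ((fun w => (w, z)) ⁻¹' (f ⁻¹' T u)) ≤ ∑ u, μ (E u) := by
    have hmeas : ∀ u, Measurable fun z => μ' ((fun w => (w, z)) ⁻¹' (f ⁻¹' T u)) := fun u =>
      measurable_measure_prodMk_right (hTm u)
    obtain ⟨z, hz⟩ := exists_le_lintegral (μ := ν)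
      (f := fun z => ∑ u, μ' ((fun w => (w, z)) ⁻¹' (f ⁻¹' T u)))
      (Finset.measurable_sum _ fun u _ => hmeas u).aemeasurable
    refine ⟨z, hz.trans ?_⟩
    rw [lintegral_finsetSum _ fun u _ => hmeas u]
    exact (Finset.sum_congr rfl fun u _ => (h1 u).symm).le
  refine ⟨fun u => Function.extend e (fun j => s * enc u j) 0,
    fun y => dec (fun j => s⁻¹ * y (e j) + z j), ?_, ?_⟩
  · intro u
    have h3 := hpow u
    unfold powerConstraint at h3 ⊢
    rw [one_div, inv_mul_le_iff₀ hL'r] at h3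
    rw [one_div, inv_mul_le_iff₀ hLr]
    have h4 : ∑ i, (Function.extend e (fun j => s * enc u j) 0 i) ^ 2 = ∑ j, (s * enc u j) ^ 2 := by
      rw [← Finset.sum_subset (Finset.subset_univ (Finset.univ.image e)),
        Finset.sum_image he.injOn]
      · refine Finset.sum_congr rfl fun j _ => ?_
        rw [he.extend_apply]
      · intro i _ hi
        rw [Function.extend_apply' _ _ _ (by simpa using hi)]
        simp
    rw [h4]
    simp_rw [mul_pow]
    rw [← Finset.mul_sum]
    calc s ^ 2 * ∑ i, enc u i ^ 2 ≤ s ^ 2 * (L' * P) := by gcongr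
      _ = (s ^ 2 * L') * P := by ring
      _ ≤ L * P := by gcongr
  · unfold avgError
    refine mul_le_mul_of_nonneg_left ?_ (by positivity)
    rw [← ENNReal.toReal_sum fun u _ => measure_ne_top _ _,
      ← ENNReal.toReal_sum fun u _ => measure_ne_top _ _]
    refine ENNReal.toReal_mono (ENNReal.sum_ne_top.2 fun u _ => measure_ne_top _ _) (le_trans ?_ hz)
    refine Finset.sum_le_sum fun u _ => measure_mono fun w hw => ?_
    change f (w, z) ∈ T u
    apply subset_toMeasurable
    change dec (fun i => enc u i + (s⁻¹ * w (e i) + z i)) ≠ u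
    have hw' : dec (fun j => s⁻¹ * (Function.extend e (fun j => s * enc u j) 0 (e j) + w (e j)) + z j) ≠ u := hw
    convert hw' using 3 with j
    rw [he.extend_apply]
    field_simp
    ring

lemma aux_dirichlet (α : ℝ) (hα : Irrational α) (τ : ℝ) (hτ : 0 < τ) :
    ∃ r : ℚ, 1 / (r.den : ℝ) ≤ τ ∧ r.den * |α - r| ≤ τ := by
  obtain ⟨N, hN⟩ := exists_nat_one_div_lt hτ
  have h1 := hα.eventually_forall_le_dist_cast_rat_of_den_le (N + 1)
  obtain ⟨δ, hδ, h2⟩ := Metric.eventually_nhds_iff.1 h1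
  have h3 := h2 (y := δ / 2) (by
    rw [Real.dist_eq, sub_zero, abs_of_pos (by positivity)]
    linarith)
  obtain ⟨m, hm⟩ := exists_nat_one_div_lt (show 0 < min τ (δ / 2) by positivity)
  have hm1 := hm.trans_le (min_le_left _ _)
  have hm2 := hm.trans_le (min_le_right _ _)
  obtain ⟨r, hr, -⟩ := Real.exists_rat_abs_sub_le_and_den_le α (Nat.succ_pos m)
  have hd : (1 : ℝ) ≤ r.den := by exact_mod_cast r.den_pos
  have hm0 : (0 : ℝ) ≤ m := Nat.cast_nonneg m
  have hmul : r.den * |α - r| ≤ 1 / (m + 1) := by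
    rw [le_div_iff₀ (by positivity)] at hr
    rw [le_div_iff₀ (by positivity)]
    push_cast at hr
    nlinarith [abs_nonneg (α - r)]
  refine ⟨r, ?_, hmul.trans hm1.le⟩
  by_contra hcon
  push Not at hcon
  have hden : r.den ≤ N + 1 := by
    by_contra h
    push Not at h
    have : (N + 1 : ℝ) ≤ r.den := by exact_mod_cast h.le
    have := one_div_le_one_div_of_le (by positivity) this
    linarith
  have h4 := h3 r hden
  rw [Real.dist_eq] at h4
  nlinarith [abs_nonneg (α - r)]

lemma aux_match (α β τ : ℝ) (r : ℚ) (h1 : 1 / (r.den : ℝ) ≤ τ) (h2 : r.den * |α - r| ≤ τ)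
    (h3 : r.den * |β - r| ≤ 2 * τ) :
    ∃ e : ℕ → ℕ, Function.Injective e ∧ (∀ j, e j < j + r.den) ∧
      ∀ j, ∃ z : ℤ, |α * j - β * e j - z| ≤ 4 * τ := by
  set q := r.den with hq
  have hq0 : 0 < q := r.den_pos
  have hqr : (0 : ℝ) < q := by exact_mod_cast hq0
  have hshift : ∀ b : ℕ, ∃ c : ℕ, ∃ k : ℤ, (c : ℤ) * r.num = ⌊(q : ℝ) * (q * b * (α - β))⌋ + k * q := by
    intro b
    have hcop : IsCoprime (r.num) (q : ℤ) := by
      rw [Int.isCoprime_iff_gcd_eq_one]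
      exact r.reduced
    obtain ⟨x, y, hxy⟩ := hcop
    set m := ⌊(q : ℝ) * (q * b * (α - β))⌋
    have hq0' : (0 : ℤ) < q := by exact_mod_cast hq0
    refine ⟨((x * m) % q).toNat, -(y * m) - ((x * m) / q) * r.num, ?_⟩
    rw [Int.toNat_of_nonneg (Int.emod_nonneg _ hq0'.ne')]
    have := Int.emod_add_mul_ediv (x * m) q
    have h5 : (x * m) % q = x * m - q * (x * m / q) := by linarith
    rw [h5]
    linear_combination m * hxy
  choose c k hc using hshift
  refine ⟨fun j => q * (j / q) + (j % q + c (j / q)) % q, ?_, ?_, ?_⟩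
  · intro j j' hjj
    simp only at hjj
    have hd : j / q = j' / q := by
      have := congrArg (· / q) hjj
      simpa [Nat.mul_add_div hq0, Nat.div_eq_of_lt (Nat.mod_lt _ hq0)] using this
    rw [hd] at hjj
    have h6 : (j % q + c (j' / q)) % q = (j' % q + c (j' / q)) % q := by omega
    have h7 : j % q ≡ j' % q [MOD q] := Nat.ModEq.add_right_cancel' _ h6
    have h8 : j % q = j' % q := by simpa [Nat.ModEq] using h7
    rw [← Nat.div_add_mod j q, ← Nat.div_add_mod j' q, hd, h8]
  · intro j
    have h5 := Nat.div_add_mod j q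
    have h6 := Nat.mod_lt (j % q + c (j / q)) hq0
    change q * (j / q) + (j % q + c (j / q)) % q < j + q
    have h7 := Nat.mul_div_le j q
    linarith
  · intro j
    set b := j / q with hb
    set i := j % q with hi
    set i' := (i + c b) % q with hi'
    set D : ℝ := q * b * (α - β) with hD
    have hj : (j : ℝ) = q * b + i := by
      rw [hb, hi]
      exact_mod_cast (Nat.div_add_mod j q).symm
    have hil : (i : ℝ) ≤ q := by exact_mod_cast (Nat.mod_lt j hq0).le
    have hil' : (i' : ℝ) ≤ q := by exact_mod_cast (Nat.mod_lt (i + c b) hq0).le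
    obtain ⟨g, hg⟩ : ∃ g : ℕ, g = (i + c b) / q := ⟨_, rfl⟩
    have hi'e : (q : ℝ) * g + i' = i + c b := by
      rw [hi', hg]
      exact_mod_cast Nat.div_add_mod (i + c b) q
    have hcR : (c b : ℝ) * r.num = ⌊(q : ℝ) * D⌋ + k b * q := by
      have := congrArg (Int.cast : ℤ → ℝ) (hc b)
      push_cast at this
      exact this
    have hr : (r : ℝ) = r.num / q := by rw [hq]; exact Rat.cast_def r
    refine ⟨-k b + (g : ℤ) * r.num, ?_⟩
    have hfl1 := Int.floor_le ((q : ℝ) * D)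
    have hfl2 := (Int.lt_floor_add_one ((q : ℝ) * D)).le
    have hmain : α * j - β * ((q * b + i' : ℕ) : ℝ) - ((-k b + (g : ℤ) * r.num : ℤ) : ℝ)
        = (D - ⌊(q : ℝ) * D⌋ / q) + i * (α - r) - i' * (β - r) := by
      rw [hj, hr]
      push_cast
      have hcb : (c b : ℝ) = q * g + i' - i := by linarith
      rw [hcb] at hcR
      have hF : (⌊(q : ℝ) * D⌋ : ℝ) = (q * g + i' - i) * r.num - k b * q := by linarith
      have hw2 : ((i : ℝ) + c b) = q * g + i' := hi'e.symm
      rw [hF, hD]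
      field_simp
      ring
    have e1 : |D - ⌊(q : ℝ) * D⌋ / q| ≤ τ := by
      refine le_trans ?_ h1
      rw [show D - ⌊(q : ℝ) * D⌋ / q = (q * D - ⌊(q : ℝ) * D⌋) / q by field_simp, abs_div,
        abs_of_pos hqr]
      gcongr
      rw [abs_le]
      constructor <;> linarith
    have e2 : |(i : ℝ) * (α - r)| ≤ τ := by
      rw [abs_mul, Nat.abs_cast]
      exact (mul_le_mul_of_nonneg_right hil (abs_nonneg _)).trans h2
    have e3 : |(i' : ℝ) * (β - r)| ≤ 2 * τ := by
      rw [abs_mul, Nat.abs_cast]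
      exact (mul_le_mul_of_nonneg_right hil' (abs_nonneg _)).trans h3
    rw [hmain]
    rw [abs_le] at e1 e2 e3 ⊢
    constructor <;> linarith

lemma aux_unif (C : ℝ → ℝ) (T : ℝ) (hT : 0 < T) (hc : Continuous C) (hper : ∀ t, C (t + T) = C t)
    (η : ℝ) (hη : 0 < η) :
    ∃ δ > 0, ∀ x y : ℝ, |x - y| < δ → |C x - C y| < η := by
  have hK : IsCompact (Set.Icc (-1) (T + 1)) := isCompact_Icc
  have hu := hK.uniformContinuousOn_of_continuous hc.continuousOn
  obtain ⟨δ, hδ, h⟩ := Metric.uniformContinuousOn_iff.1 hu η hη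
  have hp : Function.Periodic C T := hper
  refine ⟨min δ 1, by positivity, fun x y hxy => ?_⟩
  have h1 := hxy.trans_le (min_le_left _ _)
  have h2 := hxy.trans_le (min_le_right _ _)
  set n := ⌊x / T⌋
  have h3 : n * T ≤ x := by rw [← le_div_iff₀ hT]; exact Int.floor_le _
  have h4 : x ≤ n * T + T := by
    have := (Int.lt_floor_add_one (x / T)).le
    rw [div_le_iff₀ hT] at this
    linarith
  rw [abs_lt] at h2
  have := h (x - n * T) ⟨by linarith, by linarith⟩ (y - n * T) ⟨by linarith, by linarith⟩
    (by rw [Real.dist_eq]; simpa using h1)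
  rw [Real.dist_eq, hp.sub_int_mul_eq, hp.sub_int_mul_eq] at this
  exact this

lemma aux_match_C (C : ℝ → ℝ) (T : ℝ) (hT : 0 < T) (hc : Continuous C)
    (hper : ∀ t, C (t + T) = C t) (hlo : ∀ t, 1 / (2 * Real.pi) < C t)
    (α : ℝ) (hα : Irrational α) (β : ℕ → ℝ) (hβ : Tendsto β atTop (𝓝 α)) (δ : ℝ) (hδ : 0 < δ) :
    ∃ q : ℕ, ∀ᶠ n in atTop, ∃ e : ℕ → ℕ, Function.Injective e ∧ (∀ j, e j < j + q) ∧
      ∀ j, C (β n * e j * T) ≤ (1 + δ) * C (α * j * T) := by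
  have hpi := Real.pi_pos
  obtain ⟨d, hd, h⟩ := aux_unif C T hT hc hper (δ * (1 / (2 * Real.pi))) (by positivity)
  obtain ⟨r, hr1, hr2⟩ := aux_dirichlet α hα (d / (5 * T)) (by positivity)
  set τ := d / (5 * T) with hτ
  have hτ0 : 0 < τ := by positivity
  have hq0 : (0 : ℝ) < r.den := by exact_mod_cast r.den_pos
  refine ⟨r.den, ?_⟩
  filter_upwards [Metric.tendsto_nhds.1 hβ (τ / r.den) (by positivity)] with n hn
  rw [Real.dist_eq, lt_div_iff₀ hq0] at hn
  have h3 : r.den * |β n - r| ≤ 2 * τ := by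
    have := abs_sub_le (β n) α r
    nlinarith
  obtain ⟨e, he1, he2, he3⟩ := aux_match α (β n) τ r hr1 hr2 h3
  refine ⟨e, he1, he2, fun j => ?_⟩
  obtain ⟨z, hz⟩ := he3 j
  have hp : Function.Periodic C T := hper
  have h4 : C (α * j * T - z * T) = C (α * j * T) := hp.sub_int_mul_eq z
  have h5 := h (α * j * T - z * T) (β n * e j * T) (by
    rw [show α * j * T - z * T - β n * e j * T = (α * j - β n * e j - z) * T by ring, abs_mul,
      abs_of_pos hT]
    have : 5 * (τ * T) = d := by rw [hτ]; field_simp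
    nlinarith [mul_le_mul_of_nonneg_right hz hT.le, mul_pos hτ0 hT])
  rw [h4, abs_lt] at h5
  have h6 := mul_lt_mul_of_pos_left (hlo (α * j * T)) hδ
  linarith [h5.1]

lemma aux_transfer (σ2 σ2' : ℕ → ℝ) (P δ R : ℝ) (q : ℕ) (e : ℕ → ℕ) (he : Function.Injective e)
    (heq : ∀ j, e j < j + q) (hδ : 0 < δ) (hP : 0 ≤ P) (hR0 : 0 ≤ R) (h0 : ∀ i, 0 ≤ σ2' i)
    (h : ∀ j, σ2' (e j) ≤ (1 + δ) * σ2 j) (hR : IsAchievableRate σ2 P R) :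
    IsAchievableRate σ2' P (R / (1 + δ)) := by
  intro η₁ hη₁ η₂ hη₂
  obtain ⟨l₀, hl₀⟩ := hR η₁ hη₁ (η₂ / 2) (by positivity)
  have hδ1 : 0 < 1 + δ := by linarith
  obtain ⟨N1, hN1⟩ := exists_nat_ge ((1 + δ) * (l₀ + 2))
  obtain ⟨N2, hN2⟩ := exists_nat_ge (q * (1 + δ) / δ)
  obtain ⟨N3, hN3⟩ := exists_nat_ge (2 * R / η₂)
  refine ⟨N1 + N2 + N3 + 1, fun L hL => ?_⟩
  have hLr : (N1 : ℝ) + N2 + N3 + 1 < L := by exact_mod_cast hL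
  have hN1' : (0 : ℝ) ≤ N1 := Nat.cast_nonneg _
  have hN2' : (0 : ℝ) ≤ N2 := Nat.cast_nonneg _
  have hN3' : (0 : ℝ) ≤ N3 := Nat.cast_nonneg _
  have hL0 : (0 : ℝ) < L := by linarith
  set L' := ⌊(L : ℝ) / (1 + δ)⌋₊ with hL'
  have hf1 : (L' : ℝ) ≤ L / (1 + δ) := Nat.floor_le (by positivity)
  have hf2 : (L : ℝ) / (1 + δ) < L' + 1 := Nat.lt_floor_add_one _
  have hL'l₀ : l₀ < L' := by
    have h1 : (l₀ + 2 : ℝ) ≤ L / (1 + δ) := by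
      rw [le_div_iff₀ hδ1]
      linarith
    have : (l₀ : ℝ) < L' := by linarith
    exact_mod_cast this
  have hL'0 : 0 < L' := by omega
  have hL'r : (0 : ℝ) < L' := by exact_mod_cast hL'0
  have hLq : L' + q ≤ L := by
    have h1 : (q : ℝ) * (1 + δ) ≤ L * δ := by
      rw [div_le_iff₀ hδ] at hN2
      nlinarith
    have h2 : (L' : ℝ) * (1 + δ) ≤ L := by rwa [le_div_iff₀ hδ1] at hf1
    have h3 : ((L' : ℝ) + q) * (1 + δ) ≤ L * (1 + δ) := by linarith
    have := le_of_mul_le_mul_right h3 hδ1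
    exact_mod_cast this
  obtain ⟨M, enc, dec, hp, herr, hrate⟩ := hl₀ L' hL'l₀
  let e' : Fin L' → Fin L := fun j => ⟨e j, by have := heq j; have := j.2; omega⟩
  have he' : Function.Injective e' := by
    intro a b hab
    have : e a = e b := congrArg Fin.val hab
    exact Fin.ext (he this)
  have hsq : √(1 + δ) ^ 2 = 1 + δ := Real.sq_sqrt hδ1.le
  obtain ⟨enc', dec', hp', herr'⟩ := aux_sim σ2 σ2' L L' M e' he' (√(1 + δ)) P
    (Real.sqrt_pos.2 hδ1) h0 hP (fun j => by rw [hsq]; exact h j) hL'0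
    (by rw [hsq, mul_comm, ← le_div_iff₀ hδ1]; exact hf1) enc dec hp
  refine ⟨M, enc', dec', hp', herr'.trans_lt herr, ?_⟩
  rw [ge_iff_le, le_div_iff₀ hL'r] at hrate
  rw [ge_iff_le, le_div_iff₀ hL0]
  refine le_trans ?_ hrate
  have h3 : R ≤ η₂ / 2 * L := by
    rw [div_le_iff₀ hη₂] at hN3
    nlinarith
  have h4 : (L' : ℝ) ≤ L := by
    refine hf1.trans ?_
    exact div_le_self hL0.le (by linarith)
  have h5 : R / (1 + δ) * L = R * (L / (1 + δ)) := by ring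
  have h6 : R * (L / (1 + δ)) ≤ R * (L' + 1) := mul_le_mul_of_nonneg_left hf2.le hR0
  have h7 : η₂ * L' ≤ η₂ * L := mul_le_mul_of_nonneg_left h4 hη₂.le
  nlinarith

lemma aux_zero (σ2 : ℕ → ℝ) (P : ℝ) (hP : 0 ≤ P) : IsAchievableRate σ2 P 0 := by
  intro η₁ hη₁ η₂ hη₂
  refine ⟨0, fun l _ => ⟨1, fun _ _ => 0, fun _ => 0, ?_, ?_, ?_⟩⟩
  · intro u
    simp [powerConstraint, hP]
  · have : avgError σ2 l 1 (fun _ _ => 0) (fun _ => 0) = 0 := by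
      simp [avgError]
    rw [this]
    exact hη₁
  · simp [hη₂.le]

lemma aux_beta (p : ℕ) (hp : 0 < p) (ε : ℝ) (hε0 : 0 < ε) :
    Tendsto (fun n : ℕ => ((p : ℝ) + (⌊(n : ℝ) * ε⌋ : ℝ) / (n : ℝ))⁻¹) atTop
      (𝓝 ((p : ℝ) + ε)⁻¹) := by
  refine Tendsto.inv₀ ?_ (by positivity)
  refine tendsto_const_nhds.add ?_
  have h := (tendsto_nat_floor_mul_div_atTop hε0.le).comp (tendsto_natCast_atTop_atTop (R := ℝ))
  refine h.congr fun n => ?_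
  simp only [Function.comp]
  rw [mul_comm ε, natCast_floor_eq_intCast_floor (by positivity)]

/-- For irrational `ε ∈ (0,1)`, assuming `1/(2π) < C(t)` for all `t`, the
capacity `C_ε` of the channel `Y_ε[i] = X[i] + W_ε[i]` (noise variances
`σ_ε²[i] = C(i·T_c/(p+ε))`) under the average power constraint `P` satisfies
`C_ε ≤ liminf_{n→∞} C_n`, where `C_n` is the capacity of the channel with noise variances
`C(i·T_c/(p+ε_n))`, `ε_n = ⌊n·ε⌋/n`, under the same power constraint. -/
theorem stmt15 (C : ℝ → ℝ) (T_c : ℝ) (hT : 0 < T_c)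
    (hC_cont : Continuous C) (hC_pos : ∀ t, 0 < C t)
    (hC_per : ∀ t, C (t + T_c) = C t)
    (hC_lo : ∀ t, 1 / (2 * Real.pi) < C t)
    (p : ℕ) (hp : 0 < p) (ε : ℝ) (hε0 : 0 < ε) (hε1 : ε < 1) (hirr : Irrational ε)
    (P : ℝ) (hP : 0 < P) :
    capacity (fun i : ℕ => C ((i : ℝ) * T_c / ((p : ℝ) + ε))) P ≤
      Filter.liminf (fun n : ℕ =>
        capacity (fun i : ℕ =>
          C ((i : ℝ) * T_c / ((p : ℝ) + (⌊(n : ℝ) * ε⌋ : ℝ) / (n : ℝ)))) P) atTop := by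
  have hpi := Real.pi_pos
  obtain ⟨S, hS⟩ : ∃ S : ℝ, ∀ t, C t ≤ S := by
    have hb := Function.Periodic.isBounded_of_continuous (f := C) (c := T_c) hC_per hT.ne' hC_cont
    obtain ⟨S, hS⟩ := hb.bddAbove
    exact ⟨S, fun t => hS ⟨t, rfl⟩⟩
  have hS0 : 0 < S := (hC_pos 0).trans_le (hS 0)
  set α : ℝ := ((p : ℝ) + ε)⁻¹ with hα
  set β : ℕ → ℝ := fun n => ((p : ℝ) + (⌊(n : ℝ) * ε⌋ : ℝ) / (n : ℝ))⁻¹ with hβ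
  have hαirr : Irrational α := by
    rw [hα, irrational_inv_iff, irrational_natCast_add_iff]
    exact hirr
  have hβt : Tendsto β atTop (𝓝 α) := aux_beta p hp ε hε0
  set σ : ℕ → ℝ := fun i : ℕ => C ((i : ℝ) * T_c / ((p : ℝ) + ε)) with hσ
  set σn : ℕ → ℕ → ℝ := fun n i =>
    C ((i : ℝ) * T_c / ((p : ℝ) + (⌊(n : ℝ) * ε⌋ : ℝ) / (n : ℝ))) with hσn
  set K := 2 + Real.logb 2 (Real.exp (2 * (P + 4 * S)) * √Real.pi) with hK
  have hbd : ∀ n, ∀ R ∈ {R : ℝ | IsAchievableRate (σn n) P R}, R ≤ K := fun n R hR =>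
    aux_rate_bound (σn n) S P R hS0 (fun i => (hC_lo _).le) (fun i => hS _) hR
  have hcap_le : ∀ n, capacity (σn n) P ≤ K := fun n =>
    csSup_le ⟨0, aux_zero _ _ hP.le⟩ (hbd n)
  have hle_cap : ∀ n R, IsAchievableRate (σn n) P R → R ≤ capacity (σn n) P := fun n R hR =>
    le_csSup ⟨K, hbd n⟩ hR
  have hmain : ∀ δ > 0, capacity σ P / (1 + δ) ≤
      Filter.liminf (fun n : ℕ => capacity (σn n) P) atTop := by
    intro δ hδ
    obtain ⟨q, hq⟩ := aux_match_C C T_c hT hC_cont hC_per hC_lo α hαirr β hβt δ hδ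
    refine le_liminf_of_le
      (Filter.IsCoboundedUnder.of_frequently_le (a := K) (Filter.Frequently.of_forall hcap_le)) ?_
    filter_upwards [hq] with n hn
    obtain ⟨e, he1, he2, he3⟩ := hn
    have hδ1 : 0 < 1 + δ := by linarith
    rw [div_le_iff₀ hδ1]
    refine csSup_le ⟨0, aux_zero _ _ hP.le⟩ fun R hR => ?_
    have hc0 := hle_cap n 0 (aux_zero _ _ hP.le)
    rcases le_total R 0 with hR0 | hR0
    · exact hR0.trans (by positivity)
    rw [← div_le_iff₀ hδ1]
    refine hle_cap n _ (aux_transfer σ (σn n) P δ R q e he1 he2 hδ hP.le hR0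
      (fun i => (hC_pos _).le) (fun j => ?_) hR)
    have h1 := he3 j
    have e1 : σn n (e j) = C (β n * e j * T_c) := by
      simp only [hσn, hβ]
      congr 1
      rw [div_eq_mul_inv]
      ring
    have e2 : σ j = C (α * j * T_c) := by
      simp only [hσ, hα]
      congr 1
      rw [div_eq_mul_inv]
      ring
    rw [e1, e2]
    exact h1
  have hlim : Tendsto (fun δ : ℝ => capacity σ P / (1 + δ)) (𝓝[>] 0) (𝓝 (capacity σ P)) := by
    have : ContinuousAt (fun δ : ℝ => capacity σ P / (1 + δ)) 0 := by
      refine ContinuousAt.div (by fun_prop) (by fun_prop) (by norm_num)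
    have h2 := this.tendsto.mono_left (nhdsWithin_le_nhds (s := Set.Ioi 0))
    simpa using h2
  refine le_of_tendsto hlim ?_
  filter_upwards [self_mem_nhdsWithin] with δ hδ
  exact hmain δ hδ
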